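/- Let T be a completely positive operator on n × n matrices with T(I) = I (i.e., ∑ A_i A_i† = I), and suppose trace[(T*(I) - I)²] ≤ 1/(n+1). Then T is rank non-decreasing: for every positive semidefinite X, rank(T(X)) ≥ rank(X). -/

import Mathlib

open Matrix
open scoped ComplexOrder

theorem aux_proj {n : ℕ} (X : Matrix (Fin n) (Fin n) ℂ) (hX : X.IsHermitian) :
    ∃ P Y : Matrix (Fin n) (Fin n) ℂ, Pᴴ = P ∧ P * P = P ∧ X = X * P ∧ P = Y * X ∧
      P.trace = (X.rank : ℂ) := by
  set U : Matrix (Fin n) (Fin n) ℂ := (hX.eigenvectorUnitary : Matrix (Fin n) (Fin n) ℂ) with hU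
  set d : Fin n → ℂ := fun i => (hX.eigenvalues i : ℂ) with hd
  have h1 : Uᴴ * U = 1 := by
    have := Unitary.coe_star_mul_self hX.eigenvectorUnitary
    simpa [star_eq_conjTranspose] using this
  have hs : X = U * diagonal d * Uᴴ := by
    have := hX.spectral_theorem
    rw [Unitary.conjStarAlgAut_apply] at this
    exact this
  set e : Fin n → ℂ := fun i => if hX.eigenvalues i ≠ 0 then 1 else 0 with he
  have key : ∀ a b : Fin n → ℂ, (U * diagonal a * Uᴴ) * (U * diagonal b * Uᴴ)
      = U * diagonal (fun i => a i * b i) * Uᴴ := by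
    intro a b
    rw [← diagonal_mul_diagonal]
    calc _ = U * diagonal a * (Uᴴ * U) * diagonal b * Uᴴ := by simp only [Matrix.mul_assoc]
      _ = _ := by rw [h1]; simp only [Matrix.mul_assoc, Matrix.one_mul]
  refine ⟨U * diagonal e * Uᴴ, U * diagonal (fun i => (d i)⁻¹) * Uᴴ, ?_, ?_, ?_, ?_, ?_⟩
  · simp only [conjTranspose_mul, conjTranspose_conjTranspose, diagonal_conjTranspose, Matrix.mul_assoc]
    congr 3
    ext i
    by_cases h : hX.eigenvalues i = 0 <;> simp [he, h]
  · rw [key]; congr 3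
    ext i
    by_cases h : hX.eigenvalues i = 0 <;> simp [he, h]
  · conv_rhs => rw [hs]
    conv_lhs => rw [hs]
    rw [key]; congr 3
    ext i
    by_cases h : hX.eigenvalues i = 0 <;> simp [he, hd, h]
  · conv_rhs => rw [hs]
    rw [key]; congr 3
    ext i
    by_cases h : hX.eigenvalues i = 0 <;> simp [he, hd, h]
  · rw [trace_mul_comm, ← Matrix.mul_assoc, h1, Matrix.one_mul, trace_diagonal,
      hX.rank_eq_card_non_zero_eigs, Fintype.card_subtype]
    simp only [he, Finset.sum_boole]

theorem rank_nondecreasing_of_almost_doubly_stochastic (n m : ℕ)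
    (A : Fin m → Matrix (Fin n) (Fin n) ℂ)
    (hTI : ∑ i, A i * (A i)ᴴ = 1)
    (hds : (Matrix.trace ((∑ i, (A i)ᴴ * A i - 1) ^ 2)).re ≤ 1 / ((n : ℝ) + 1)) :
    ∀ X : Matrix (Fin n) (Fin n) ℂ, X.PosSemidef →
      X.rank ≤ (∑ i, A i * X * (A i)ᴴ).rank := by
  intro X hX
  by_contra hlt
  push Not at hlt
  set Z := ∑ i, A i * X * (A i)ᴴ with hZdef
  have hZ : Z.PosSemidef := Matrix.posSemidef_sum _ fun i _ => hX.mul_mul_conjTranspose_same (A i)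
  obtain ⟨P, Y, hP1, hP2, hP3, hP4, hP5⟩ := aux_proj X hX.1
  obtain ⟨Q, Y', hQ1, hQ2, hQ3, hQ4, hQ5⟩ := aux_proj Z hZ.1
  have hZR : Z * (1 - Q) = 0 := by rw [Matrix.mul_sub, Matrix.mul_one, ← hQ3, sub_self]
  obtain ⟨C, hC⟩ : ∃ C : Matrix (Fin n) (Fin n) ℂ, X = Cᴴ * C :=
    by
      open scoped MatrixOrder in
      exact CStarAlgebra.nonneg_iff_eq_star_mul_self.mp hX.nonneg
  have hW : ∀ i, C * (A i)ᴴ * (1 - Q) = 0 := by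
    have hsum : ∑ i, ((C * (A i)ᴴ * (1 - Q))ᴴ * (C * (A i)ᴴ * (1 - Q))).trace = 0 := by
      rw [← trace_sum]
      have : ∑ i, ((C * (A i)ᴴ * (1 - Q))ᴴ * (C * (A i)ᴴ * (1 - Q))) = (1 - Q) * (Z * (1 - Q)) := by
        rw [hZdef, hC, Finset.sum_mul, Finset.mul_sum]
        refine Finset.sum_congr rfl fun i _ => ?_
        simp only [conjTranspose_mul, conjTranspose_conjTranspose, conjTranspose_sub,
          conjTranspose_one, hQ1, Matrix.mul_assoc]
      rw [this, hZR]; simp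
    intro i
    have := (Finset.sum_eq_zero_iff_of_nonneg (fun i _ =>
      (posSemidef_conjTranspose_mul_self (C * (A i)ᴴ * (1 - Q))).trace_nonneg)).mp hsum i
        (Finset.mem_univ i)
    exact trace_conjTranspose_mul_self_eq_zero_iff.mp this
  have hPR : ∀ i, P * (A i)ᴴ * (1 - Q) = 0 := by
    intro i
    rw [hP4, hC]
    have := hW i
    calc _ = Y * Cᴴ * (C * (A i)ᴴ * (1 - Q)) := by simp only [Matrix.mul_assoc]
      _ = 0 := by rw [this, Matrix.mul_zero]
  set TP := ∑ i, A i * P * (A i)ᴴ with hTP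
  have hTPR : TP * (1 - Q) = 0 := by
    rw [hTP, Finset.sum_mul]
    refine Finset.sum_eq_zero fun i _ => ?_
    have := hPR i
    calc _ = A i * (P * (A i)ᴴ * (1 - Q)) := by simp only [Matrix.mul_assoc]
      _ = 0 := by rw [this, Matrix.mul_zero]
  have hTPQ : TP = TP * Q := by
    rw [Matrix.mul_sub, Matrix.mul_one, sub_eq_zero] at hTPR
    exact hTPR
  have h1P : (1 - P).PosSemidef := by
    have : 1 - P = (1 - P)ᴴ * (1 - P) := by
      rw [conjTranspose_sub, conjTranspose_one, hP1]
      simp [Matrix.mul_sub, Matrix.sub_mul, hP2]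
    rw [this]; exact posSemidef_conjTranspose_mul_self _
  have hpos : (1 - TP).PosSemidef := by
    have : 1 - TP = ∑ i, A i * (1 - P) * (A i)ᴴ := by
      simp only [Matrix.mul_sub, Matrix.sub_mul, Finset.sum_sub_distrib, Matrix.mul_one, hTI, hTP]
    rw [this]
    exact Matrix.posSemidef_sum _ fun i _ => h1P.mul_mul_conjTranspose_same (A i)
  have htr : 0 ≤ (Q * (1 - TP) * Qᴴ).trace := (hpos.mul_mul_conjTranspose_same Q).trace_nonneg
  have htr2 : (Q * (1 - TP) * Qᴴ).trace = (Z.rank : ℂ) - TP.trace := by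
    rw [hQ1, trace_mul_comm, ← Matrix.mul_assoc, hQ2, trace_mul_comm, Matrix.sub_mul, ← hTPQ,
      Matrix.one_mul, trace_sub, hQ5]
  set B := ∑ i, (A i)ᴴ * A i - 1 with hB
  have hBH : Bᴴ = B := by
    simp [hB, conjTranspose_sum]
  have htT : TP.trace = (X.rank : ℂ) + (P * B).trace := by
    have h2 : (P * B).trace = TP.trace - P.trace := by
      rw [hB, Matrix.mul_sub, Matrix.mul_one, trace_sub, Finset.mul_sum, trace_sum, hTP, trace_sum]
      congr 1
      refine Finset.sum_congr rfl fun i _ => ?_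
      rw [← Matrix.mul_assoc, trace_mul_comm, Matrix.mul_assoc]
    rw [h2, hP5]; ring
  have hb : (X.rank : ℝ) + (P * B).trace.re ≤ Z.rank := by
    rw [htr2, htT] at htr
    have := (Complex.le_def.mp htr).1
    simp at this
    linarith
  have hlt' : (Z.rank : ℝ) + 1 ≤ X.rank := by exact_mod_cast hlt
  have hrn : (X.rank : ℝ) ≤ n := by
    have := X.rank_le_width
    exact_mod_cast this
  set t : ℝ := 1 / ((n : ℝ) + 1) with ht
  have hq : 0 ≤ t ^ 2 * X.rank + 2 * t * (P * B).trace.re + (B ^ 2).trace.re := by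
    have h3 := (posSemidef_conjTranspose_mul_self ((t : ℂ) • P + B)).trace_nonneg
    have h4 : (((t : ℂ) • P + B)ᴴ * ((t : ℂ) • P + B)).trace
        = (t : ℂ) ^ 2 * X.rank + 2 * t * (P * B).trace + (B ^ 2).trace := by
      rw [conjTranspose_add, conjTranspose_smul, hP1, hBH]
      simp only [Matrix.mul_add, Matrix.add_mul, trace_add, Matrix.smul_mul, Matrix.mul_smul,
        trace_smul, hP2, hP5, pow_two, trace_mul_comm B P, smul_eq_mul]
      simp
      ring
    rw [h4] at h3
    have := (Complex.le_def.mp h3).1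
    have e1 : ((t : ℂ) ^ 2 * X.rank + 2 * t * (P * B).trace + (B ^ 2).trace).re
      = t ^ 2 * X.rank + 2 * t * (P * B).trace.re + (B ^ 2).trace.re := by
      have e2 : (t : ℂ) ^ 2 * X.rank = ((t ^ 2 * X.rank : ℝ) : ℂ) := by push_cast; ring
      have e3 : 2 * (t : ℂ) = ((2 * t : ℝ) : ℂ) := by push_cast; ring
      rw [e2, e3, Complex.add_re, Complex.add_re, Complex.re_ofReal_mul, Complex.ofReal_re]
    rw [e1] at this
    simpa using this
  have htpos : 0 < t := by positivity
  have htn : t * (n + 1) = 1 := by rw [ht]; field_simp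
  have hb2 : (P * B).trace.re ≤ -1 := by linarith
  have f1 : t * (P * B).trace.re ≤ t * (-1) := mul_le_mul_of_nonneg_left hb2 htpos.le
  have f2 : t ^ 2 * X.rank ≤ t ^ 2 * n := mul_le_mul_of_nonneg_left hrn (by positivity)
  have f3 : t ^ 2 * n = t - t ^ 2 := by linear_combination t * htn
  have f4 : 0 < t ^ 2 := by positivity
  linarith
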